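/- For n ≥ 1 let p_n be the number of isomorphism classes of planted Δ-trees of order n, and let p_n^{(Δ−1)} be the number of isomorphism classes of planted Δ-trees of order n in which the root has at most Δ−2 neighbours (i.e. the root has effective degree at most Δ−1). Let x₀ ∈ (0, ∞) be the radius of convergence of the power series Σ_{n≥1} p_n xⁿ. Then the series Σ_{n≥1} p_n^{(Δ−1)} x₀ⁿ converges and Σ_{n≥1} p_n^{(Δ−1)} x₀ⁿ = 1. -/

import Mathlib

open Filter Topology MeasureTheory

namespace TreePaper

/-- The degree of a vertex `v` in a simple graph on `Fin n`. -/
noncomputable def degr {n : ℕ} (G : SimpleGraph (Fin n)) (v : Fin n) : ℕ :=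
  Nat.card {u : Fin n // G.Adj v u}

/-- A `Δ`-tree of order `n`: a tree on `n` vertices with all degrees at most `Δ`. -/
abbrev DTree (Δ n : ℕ) : Type :=
  {G : SimpleGraph (Fin n) // G.IsTree ∧ ∀ v, degr G v ≤ Δ}

instance treeSetoid (Δ n : ℕ) : Setoid (DTree Δ n) where
  r G H := Nonempty (G.1 ≃g H.1)
  iseqv :=
    ⟨fun G => ⟨SimpleGraph.Iso.refl⟩, fun ⟨e⟩ => ⟨e.symm⟩, fun ⟨e⟩ ⟨f⟩ => ⟨e.trans f⟩⟩

/-- Isomorphism classes of `Δ`-trees of order `n`. -/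
abbrev TClass (Δ n : ℕ) : Type := Quotient (treeSetoid Δ n)

/-- The number of vertices of degree `j` in `G`. -/
noncomputable def vcount {n : ℕ} (j : ℕ) (G : SimpleGraph (Fin n)) : ℕ :=
  Nat.card {v : Fin n // degr G v = j}

/-- The number of vertices of degree `j`, as a random variable on iso classes. -/
noncomputable def Xdeg (Δ n j : ℕ) (c : TClass Δ n) : ℕ :=
  vcount j (Quotient.out c).1

/-- Probability of an event under the uniform measure on iso classes of `Δ`-trees. -/
noncomputable def prob (Δ n : ℕ) (P : TClass Δ n → Prop) : ℝ :=
  (Nat.card {c : TClass Δ n // P c} : ℝ) / (Nat.card (TClass Δ n) : ℝ)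

/-- Expectation under the uniform measure on iso classes of `Δ`-trees. -/
noncomputable def mean (Δ n : ℕ) (f : TClass Δ n → ℝ) : ℝ :=
  (∑ᶠ c : TClass Δ n, f c) / (Nat.card (TClass Δ n) : ℝ)

/-- Variance under the uniform measure on iso classes of `Δ`-trees. -/
noncomputable def variance (Δ n : ℕ) (f : TClass Δ n → ℝ) : ℝ :=
  (∑ᶠ c : TClass Δ n, (f c - mean Δ n f) ^ 2) / (Nat.card (TClass Δ n) : ℝ)

/-- The standard normal distribution function. -/
noncomputable def stdNormalCDF (t : ℝ) : ℝ :=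
  (Real.sqrt (2 * Real.pi))⁻¹ * ∫ s in Set.Iic t, Real.exp (-(s ^ 2) / 2)


/-- A rooted `Δ`-tree of order `n`. -/
abbrev RTree (Δ n : ℕ) : Type :=
  {p : SimpleGraph (Fin n) × Fin n // p.1.IsTree ∧ ∀ v, degr p.1 v ≤ Δ}

instance rootedSetoid (Δ n : ℕ) : Setoid (RTree Δ n) where
  r p q := ∃ φ : p.1.1 ≃g q.1.1, φ p.1.2 = q.1.2
  iseqv := by
    refine ⟨fun p => ⟨SimpleGraph.Iso.refl, rfl⟩, ?_, ?_⟩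
    · rintro p q ⟨φ, h⟩
      exact ⟨φ.symm, by rw [← h]; simp⟩
    · rintro p q r ⟨φ, h₁⟩ ⟨ψ, h₂⟩
      exact ⟨φ.trans ψ, by rw [← h₂, ← h₁]; rfl⟩

/-- Isomorphism classes of rooted `Δ`-trees of order `n`. -/
abbrev RClass (Δ n : ℕ) : Type := Quotient (rootedSetoid Δ n)

/-- A planted `Δ`-tree of order `n`: the root has at most `Δ - 1` neighbours and every
other vertex has degree at most `Δ`. -/
abbrev PTree (Δ n : ℕ) : Type :=
  {p : SimpleGraph (Fin n) × Fin n // p.1.IsTree ∧ degr p.1 p.2 ≤ Δ - 1 ∧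
    ∀ v, v ≠ p.2 → degr p.1 v ≤ Δ}

instance plantedSetoid (Δ n : ℕ) : Setoid (PTree Δ n) where
  r p q := ∃ φ : p.1.1 ≃g q.1.1, φ p.1.2 = q.1.2
  iseqv := by
    refine ⟨fun p => ⟨SimpleGraph.Iso.refl, rfl⟩, ?_, ?_⟩
    · rintro p q ⟨φ, h⟩
      exact ⟨φ.symm, by rw [← h]; simp⟩
    · rintro p q r ⟨φ, h₁⟩ ⟨ψ, h₂⟩
      exact ⟨φ.trans ψ, by rw [← h₂, ← h₁]; rfl⟩

/-- Isomorphism classes of planted `Δ`-trees of order `n`. -/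
abbrev PClass (Δ n : ℕ) : Type := Quotient (plantedSetoid Δ n)

/-- The effective degree of a vertex of a planted (or rooted) tree: its degree, except that
the root's degree is increased by one, accounting for the plant edge. -/
noncomputable def edeg {n : ℕ} (p : SimpleGraph (Fin n) × Fin n) (v : Fin n) : ℕ :=
  degr p.1 v + if v = p.2 then 1 else 0


/-- `p_n`: the number of iso classes of planted `Δ`-trees of order `n`. -/
noncomputable def pTotal (Δ n : ℕ) : ℕ := Nat.card (PClass Δ n)

/-- `p_n^{(Δ−1)}`: the number of iso classes of planted `Δ`-trees of order `n` whose root has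
at most `Δ − 2` neighbours (i.e. effective degree at most `Δ − 1`). -/
noncomputable def pResTotal (Δ n : ℕ) : ℕ :=
  Nat.card {c : PClass Δ n //
    degr (Quotient.out c).1.1 (Quotient.out c).1.2 ≤ Δ - 2}

section trees

open SimpleGraph

/-- The degree of a vertex of a graph on an arbitrary vertex type. -/
noncomputable def deg {V : Type} (G : SimpleGraph V) (v : V) : ℕ := (G.neighborSet v).ncard

lemma deg_iso {V W : Type} {G : SimpleGraph V} {H : SimpleGraph W} (φ : G ≃g H) (v : V) :
    deg H (φ v) = deg G v :=
  (Nat.card_congr (φ.mapNeighborSet v)).symm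

lemma sum_deg_eq {V : Type} [Fintype V] (G : SimpleGraph V) :
    ∑ v, deg G v = 2 * Nat.card G.edgeSet := by
  classical
  rw [Nat.card_eq_fintype_card, ← edgeFinset_card, ← sum_degrees_eq_twice_card_edges]
  refine Finset.sum_congr rfl fun v _ => ?_
  rw [← card_neighborSet_eq_degree, ← Nat.card_eq_fintype_card]
  rfl

lemma isTree_iff_connected_and_sum_deg {V : Type} [Fintype V] (G : SimpleGraph V) :
    G.IsTree ↔ G.Connected ∧ ∑ v, deg G v + 2 = 2 * Fintype.card V := by
  rw [isTree_iff_connected_and_card, sum_deg_eq, Nat.card_eq_fintype_card (α := V)]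
  refine and_congr_right fun _ => ?_
  omega

/-- The disjoint union of a family of graphs. -/
inductive SigmaAdj {I : Type} {V : I → Type} (G : ∀ i, SimpleGraph (V i)) :
    (Σ i, V i) → (Σ i, V i) → Prop
  | mk (i : I) (a b : V i) : (G i).Adj a b → SigmaAdj G ⟨i, a⟩ ⟨i, b⟩

lemma sigmaAdj_iff {I : Type} {V : I → Type} {G : ∀ i, SimpleGraph (V i)} {i : I} {a b : V i} :
    SigmaAdj G ⟨i, a⟩ ⟨i, b⟩ ↔ (G i).Adj a b :=
  ⟨fun h => by cases h; assumption, fun h => .mk i a b h⟩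

/-- The graph obtained from a family of rooted graphs by joining all their roots to a new
vertex `none`. -/
def graft {I : Type} {V : I → Type} (G : ∀ i, SimpleGraph (V i)) (r : ∀ i, V i) :
    SimpleGraph (Option (Σ i, V i)) where
  Adj x y := match x, y with
    | none, none => False
    | none, some b => b.2 = r b.1
    | some a, none => a.2 = r a.1
    | some a, some b => SigmaAdj G a b
  symm := ⟨by
    rintro (_ | a) (_ | b) h
    · exact h
    · exact h
    · exact h
    · obtain ⟨i, a, b, h⟩ := h
      exact .mk i b a h.symm⟩
  loopless := ⟨by
    rintro (_ | a) h
    · exact h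
    · cases h with
      | mk i a b h => exact (G i).loopless.irrefl _ h⟩

section graft

variable {I : Type} {V : I → Type} {G : ∀ i, SimpleGraph (V i)} {r : ∀ i, V i}

lemma graft_adj_none_some {i : I} {a : V i} :
    (graft G r).Adj none (some ⟨i, a⟩) ↔ a = r i := Iff.rfl

lemma graft_adj_some_some {i : I} {a b : V i} :
    (graft G r).Adj (some ⟨i, a⟩) (some ⟨i, b⟩) ↔ (G i).Adj a b := sigmaAdj_iff

lemma deg_graft_none : deg (graft G r) none = Nat.card I := by
  have : (graft G r).neighborSet none = Set.range fun i => some ⟨i, r i⟩ := by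
    ext x
    rcases x with _ | ⟨i, a⟩
    · simp
    · rw [mem_neighborSet, graft_adj_none_some]
      constructor
      · rintro rfl
        exact ⟨i, rfl⟩
      · rintro ⟨j, h⟩
        cases h
        rfl
  rw [deg, this, ← Set.image_univ, Set.ncard_image_of_injective, Set.ncard_univ]
  intro i j h
  cases h
  rfl

lemma deg_graft_some [∀ i, Finite (V i)] [DecidableEq (Σ i, V i)] (i : I) (a : V i) :
    deg (graft G r) (some ⟨i, a⟩) =
      deg (G i) a + if (⟨i, a⟩ : Σ i, V i) = ⟨i, r i⟩ then 1 else 0 := by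
  have hinj : Function.Injective fun b : V i => (some ⟨i, b⟩ : Option (Σ i, V i)) := by
    intro b c h
    cases h
    rfl
  have h1 : (graft G r).neighborSet (some ⟨i, a⟩) =
      (fun b => some ⟨i, b⟩) '' (G i).neighborSet a ∪ {x | x = none ∧ a = r i} := by
    ext x
    rcases x with _ | ⟨j, b⟩
    · simp only [mem_neighborSet, adj_comm, graft_adj_none_some]
      simp
    · simp only [Set.mem_union, Set.mem_ofPred_eq, reduceCtorEq, false_and, or_false,
        mem_neighborSet]
      constructor
      · intro h
        cases h with
        | mk _ _ _ h => exact ⟨_, h, rfl⟩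
      · rintro ⟨c, h, h'⟩
        cases h'
        exact .mk _ _ _ h
  have hfin : {x : Option (Σ i, V i) | x = none ∧ a = r i}.Finite :=
    (Set.finite_singleton none).subset fun x hx => hx.1
  rw [deg, h1, Set.ncard_union_eq _ (Set.toFinite _) hfin, Set.ncard_image_of_injective _ hinj]
  · congr 1
    by_cases h : a = r i
    · simp [h]
    · have : (⟨i, a⟩ : Σ i, V i) ≠ ⟨i, r i⟩ := fun h' => h (by cases h'; rfl)
      simp [h]
  · rw [Set.disjoint_left]
    rintro _ ⟨b, _, rfl⟩ ⟨h, _⟩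
    cases h

lemma graft_connected (hG : ∀ i, (G i).Connected) : (graft G r).Connected := by
  rw [connected_iff_exists_forall_reachable]
  refine ⟨none, ?_⟩
  rintro (_ | ⟨i, a⟩)
  · rfl
  · have h1 : (graft G r).Adj none (some ⟨i, r i⟩) := graft_adj_none_some.2 rfl
    refine h1.reachable.trans ?_
    let f : G i →g graft G r := ⟨fun b => some ⟨i, b⟩, fun h => graft_adj_some_some.2 h⟩
    exact ((hG i).preconnected (r i) a).map f

lemma graft_isTree [Finite I] [∀ i, Finite (V i)] (hG : ∀ i, (G i).IsTree) :
    (graft G r).IsTree := by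
  classical
  have := Fintype.ofFinite I
  have := fun i => Fintype.ofFinite (V i)
  rw [isTree_iff_connected_and_sum_deg]
  refine ⟨graft_connected fun i => (hG i).connected, ?_⟩
  rw [Fintype.sum_option, Fintype.card_option, Fintype.card_sigma, Fintype.sum_sigma,
    deg_graft_none, Nat.card_eq_fintype_card]
  have key : ∀ i, ∑ a, deg (graft G r) (some ⟨i, a⟩) + 1 = 2 * Fintype.card (V i) := by
    intro i
    have h := ((isTree_iff_connected_and_sum_deg (G i)).1 (hG i)).2
    have h2 : ∑ a : V i, (if (⟨i, a⟩ : Σ i, V i) = ⟨i, r i⟩ then 1 else 0) = 1 := by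
      rw [Finset.sum_eq_single (r i)]
      · simp
      · intro b _ hb
        rw [if_neg]
        intro h'
        cases h'
        exact hb rfl
      · simp
    simp only [deg_graft_some, Finset.sum_add_distrib, h2]
    omega
  have h3 := Finset.sum_congr rfl fun (i : I) (_ : i ∈ Finset.univ) => key i
  rw [Finset.sum_add_distrib, ← Finset.mul_sum] at h3
  simp only [Finset.sum_const, Finset.card_univ, smul_eq_mul, mul_one] at h3
  omega

end graft

/-- A root-preserving isomorphism between grafts maps each branch onto a branch. -/
lemma exists_branch_of_iso {I J : Type} {V : I → Type} {W : J → Type}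
    {G : ∀ i, SimpleGraph (V i)} {H : ∀ j, SimpleGraph (W j)} {r : ∀ i, V i} {s : ∀ j, W j}
    (hG : ∀ i, (G i).Connected) (φ : graft G r ≃g graft H s) (hφ : φ none = none) (i : I) :
    ∃ j, φ (some ⟨i, r i⟩) = some ⟨j, s j⟩ ∧ ∀ a, ∃ b, φ (some ⟨i, a⟩) = some ⟨j, b⟩ := by
  have h1 : (graft H s).Adj none (φ (some ⟨i, r i⟩)) := by
    rw [← hφ, φ.map_adj_iff]
    exact graft_adj_none_some.2 rfl
  obtain ⟨j, hj⟩ : ∃ j, φ (some ⟨i, r i⟩) = some ⟨j, s j⟩ := by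
    rcases h : φ (some ⟨i, r i⟩) with _ | ⟨j, b⟩
    · rw [h] at h1
      exact h1.elim
    · rw [h, graft_adj_none_some] at h1
      exact ⟨j, by rw [h1]⟩
  refine ⟨j, hj, fun a => ?_⟩
  have h2 := (hG i).preconnected (r i) a
  rw [reachable_iff_reflTransGen] at h2
  induction h2 with
  | refl => exact ⟨_, hj⟩
  | @tail b c _ hbc ih =>
    obtain ⟨b', hb'⟩ := ih
    have h3 : (graft H s).Adj (φ (some ⟨i, b⟩)) (φ (some ⟨i, c⟩)) := by
      rw [φ.map_adj_iff]
      exact graft_adj_some_some.2 hbc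
    rw [hb'] at h3
    rcases h : φ (some ⟨i, c⟩) with _ | ⟨k, d⟩
    · have : φ (some ⟨i, c⟩) = φ none := by rw [h, hφ]
      cases φ.injective this
    · rw [h] at h3
      cases h3 with
      | mk _ _ _ _ => exact ⟨_, rfl⟩

/-- Isomorphic grafts have the same branches up to reindexing and isomorphism. -/
lemma exists_equiv_of_graft_iso {I J : Type} {V : I → Type} {W : J → Type}
    {G : ∀ i, SimpleGraph (V i)} {H : ∀ j, SimpleGraph (W j)} {r : ∀ i, V i} {s : ∀ j, W j}
    (hG : ∀ i, (G i).Connected) (hH : ∀ j, (H j).Connected)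
    (φ : graft G r ≃g graft H s) (hφ : φ none = none) :
    ∃ σ : I ≃ J, ∀ i, ∃ ψ : G i ≃g H (σ i), ψ (r i) = s (σ i) := by
  have hφ' : φ.symm none = none := by rw [← hφ, φ.symm_apply_apply]
  choose f hf hfb using exists_branch_of_iso hG φ hφ
  choose g hg hgb using exists_branch_of_iso hH φ.symm hφ'
  have hgf : ∀ i, g (f i) = i := by
    intro i
    have h := hg (f i)
    rw [← hf i, φ.symm_apply_apply] at h
    exact (congrArg Sigma.fst (Option.some.inj h)).symm
  have hfg : ∀ j, f (g j) = j := by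
    intro j
    have h := hf (g j)
    rw [← hg j, φ.apply_symm_apply] at h
    exact (congrArg Sigma.fst (Option.some.inj h)).symm
  refine ⟨⟨f, g, hgf, hfg⟩, fun i => ?_⟩
  choose t ht using hfb i
  have hinj : Function.Injective t := by
    intro a b hab
    have h : φ (some ⟨i, a⟩) = φ (some ⟨i, b⟩) := by rw [ht, ht, hab]
    cases φ.injective h
    rfl
  have hsurj : Function.Surjective t := by
    intro b
    have hcast : ∀ k, k = i → ∀ a : V k, φ.symm (some ⟨f i, b⟩) = some ⟨k, a⟩ →
        ∃ a', φ.symm (some ⟨f i, b⟩) = some ⟨i, a'⟩ := by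
      rintro _ rfl a h
      exact ⟨a, h⟩
    obtain ⟨a', ha'⟩ := hgb (f i) b
    obtain ⟨a, ha⟩ := hcast _ (hgf i) a' ha'
    have h := ht a
    rw [← ha, φ.apply_symm_apply] at h
    exact ⟨a, by simpa using h.symm⟩
  refine ⟨⟨Equiv.ofBijective t ⟨hinj, hsurj⟩, ?_⟩, ?_⟩
  · intro a b
    change (H (f i)).Adj (t a) (t b) ↔ _
    rw [← graft_adj_some_some (G := H) (r := s), ← ht, ← ht, φ.map_adj_iff, graft_adj_some_some]
  · change t (r i) = s (f i)
    have h := ht (r i)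
    rw [hf] at h
    simpa using h.symm

/-- The vertices that can be reached from `u` by a walk that avoids `r`. -/
def branch {V : Type} (G : SimpleGraph V) (r u : V) : Set V :=
  {v | ∃ p : G.Walk u v, r ∉ p.support}

section branch

variable {V : Type} {G : SimpleGraph V} {r u u' v v' : V}

lemma ne_of_mem_branch (h : v ∈ branch G r u) : v ≠ r := by
  obtain ⟨p, hp⟩ := h
  rintro rfl
  exact hp p.end_mem_support

lemma self_mem_branch (h : u ≠ r) : u ∈ branch G r u := ⟨.nil, by simpa using h.symm⟩

lemma mem_branch_of_adj (h : v ∈ branch G r u) (hv : G.Adj v v') (hr : v' ≠ r) :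
    v' ∈ branch G r u := by
  obtain ⟨p, hp⟩ := h
  exact ⟨p.concat hv, by simp [Walk.support_concat, hp, hr.symm]⟩

lemma branch_connected (h : u ≠ r) : (G.induce (branch G r u)).Connected := by
  classical
  rw [connected_iff_exists_forall_reachable]
  refine ⟨⟨u, self_mem_branch h⟩, ?_⟩
  rintro ⟨v, p, hp⟩
  have hmem : ∀ x ∈ p.support, x ∈ branch G r u := fun x hx =>
    ⟨p.takeUntil x hx, fun hr => hp (p.support_takeUntil_subset_support hx hr)⟩
  exact ⟨p.induce _ hmem⟩

lemma exists_mem_branch (hG : G.Connected) (hv : v ≠ r) : ∃ u, G.Adj r u ∧ v ∈ branch G r u := by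
  obtain ⟨p, hp⟩ := (hG.preconnected r v).exists_isPath
  cases p with
  | nil => exact (hv rfl).elim
  | cons h q =>
    rw [Walk.cons_isPath_iff] at hp
    exact ⟨_, h, q, hp.2⟩

lemma eq_of_mem_branch_of_adj (hG : G.IsAcyclic) (hu : G.Adj r u) (hu' : G.Adj r u')
    (h : u' ∈ branch G r u) : u = u' := by
  classical
  obtain ⟨p, hp⟩ := h
  have hq : (Walk.cons hu p.bypass).IsPath := by
    rw [Walk.cons_isPath_iff]
    exact ⟨p.bypass_isPath, fun h => hp (p.support_bypass_subset_support h)⟩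
  have := hG.eq_snd_of_adj_start hq hu' (by simp)
  simpa using this.symm

lemma eq_of_mem_branch (hG : G.IsAcyclic) (hu : G.Adj r u) (hu' : G.Adj r u')
    (h : v ∈ branch G r u) (h' : v ∈ branch G r u') : u = u' := by
  obtain ⟨p, hp⟩ := h
  obtain ⟨q, hq⟩ := h'
  refine eq_of_mem_branch_of_adj hG hu hu' ⟨p.append q.reverse, ?_⟩
  simp [Walk.mem_support_append_iff, hp, hq]

lemma deg_induce_le [Finite V] (s : Set V) (v : s) : deg (G.induce s) v ≤ deg G v := by
  have : (Subtype.val '' (G.induce s).neighborSet v) ⊆ G.neighborSet v := by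
    rintro _ ⟨w, hw, rfl⟩
    exact hw
  rw [deg, ← Set.ncard_image_of_injective _ Subtype.val_injective]
  exact Set.ncard_le_ncard this

lemma deg_induce_lt [Finite V] {s : Set V} {v : s} {w : V} (hw : w ∉ s) (h : G.Adj v w) :
    deg (G.induce s) v < deg G v := by
  have : (Subtype.val '' (G.induce s).neighborSet v) ⊂ G.neighborSet v := by
    rw [Set.ssubset_iff_of_subset]
    · refine ⟨w, h, ?_⟩
      rintro ⟨x, _, rfl⟩
      exact hw x.2
    · rintro _ ⟨w, hw, rfl⟩
      exact hw
  rw [deg, ← Set.ncard_image_of_injective _ Subtype.val_injective]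
  exact Set.ncard_lt_ncard this

/-- A tree is the graft of its branches at the root. -/
lemma exists_graft_iso (hG : G.IsTree) {I : Type} {W : I → Type} {A : ∀ i, SimpleGraph (W i)}
    {s : ∀ i, W i} (σ : I ≃ G.neighborSet r)
    (ψ : ∀ i, A i ≃g G.induce (branch G r (σ i))) (hψ : ∀ i, (ψ i (s i)).1 = σ i) :
    ∃ φ : graft A s ≃g G, φ none = r := by
  let f : Option (Σ i, W i) → V := fun x => match x with
    | none => r
    | some a => (ψ a.1 a.2).1
  have hf : ∀ i (a : W i), f (some ⟨i, a⟩) = (ψ i a).1 := fun _ _ => rfl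
  have hidx : ∀ i j (a : W i) (b : W j), (ψ i a).1 ∈ branch G r (σ j) → i = j := by
    intro i j a b h
    exact σ.injective (Subtype.ext (eq_of_mem_branch hG.isAcyclic (σ i).2 (σ j).2 (ψ i a).2 h))
  have hinj : Function.Injective f := by
    rintro (_ | ⟨i, a⟩) (_ | ⟨j, b⟩) h
    · rfl
    · exact (ne_of_mem_branch (ψ j b).2 h.symm).elim
    · exact (ne_of_mem_branch (ψ i a).2 h).elim
    · rw [hf, hf] at h
      obtain rfl := hidx i j a b (h ▸ (ψ j b).2)
      rw [(ψ i).injective (Subtype.ext h)]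
  have hsurj : Function.Surjective f := by
    intro v
    by_cases hv : v = r
    · exact ⟨none, hv.symm⟩
    · obtain ⟨u, hu, hvu⟩ := exists_mem_branch hG.connected hv
      obtain ⟨i, hi⟩ := σ.surjective ⟨u, hu⟩
      have hvu' : v ∈ branch G r (σ i) := by rwa [hi]
      exact ⟨some ⟨i, (ψ i).symm ⟨v, hvu'⟩⟩, by simp [hf]⟩
  have hroot : ∀ i (a : W i), G.Adj r (ψ i a).1 ↔ a = s i := by
    intro i a
    constructor
    · intro h
      have := eq_of_mem_branch_of_adj hG.isAcyclic (σ i).2 h (ψ i a).2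
      exact (ψ i).injective (Subtype.ext (this.symm.trans (hψ i).symm))
    · rintro rfl
      rw [hψ]
      exact (σ i).2
  refine ⟨⟨Equiv.ofBijective f ⟨hinj, hsurj⟩, ?_⟩, rfl⟩
  rintro (_ | ⟨i, a⟩) (_ | ⟨j, b⟩)
  · simp
  · exact hroot j b
  · rw [G.adj_comm, (graft A s).adj_comm]
    exact hroot i a
  · change G.Adj (ψ i a).1 (ψ j b).1 ↔ SigmaAdj A _ _
    constructor
    · intro h
      obtain rfl := hidx j i b a (mem_branch_of_adj (ψ i a).2 h (ne_of_mem_branch (ψ j b).2))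
      exact .mk _ _ _ ((ψ j).map_adj_iff.1 h)
    · intro h
      cases h with
      | mk _ _ _ h => exact (ψ i).map_adj_iff.2 h

end branch

/-- A rooted graph is a planted `Δ`-tree. -/
def IsPlanted (Δ : ℕ) {V : Type} (G : SimpleGraph V) (r : V) : Prop :=
  G.IsTree ∧ deg G r ≤ Δ - 1 ∧ ∀ v, v ≠ r → deg G v ≤ Δ

lemma IsPlanted.of_iso {Δ : ℕ} {V W : Type} {G : SimpleGraph V} {H : SimpleGraph W} {r : V}
    {s : W} (h : IsPlanted Δ G r) (φ : G ≃g H) (hφ : φ r = s) : IsPlanted Δ H s := by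
  refine ⟨φ.isTree_iff.1 h.1, ?_, fun v hv => ?_⟩
  · rw [← hφ, deg_iso]
    exact h.2.1
  · rw [← φ.apply_symm_apply v, deg_iso]
    refine h.2.2 _ ?_
    rintro h'
    exact hv (by rw [← hφ, ← h', φ.apply_symm_apply])

lemma IsPlanted.branch {Δ : ℕ} {V : Type} [Finite V] {G : SimpleGraph V} {r u : V}
    (h : IsPlanted Δ G r) (hu : G.Adj r u) :
    IsPlanted Δ (G.induce (branch G r u)) ⟨u, self_mem_branch hu.ne'⟩ := by
  have hr : r ∉ TreePaper.branch G r u := fun h => ne_of_mem_branch h rfl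
  refine ⟨⟨branch_connected hu.ne', h.1.isAcyclic.induce _⟩, ?_, fun v _ => ?_⟩
  · have h1 := deg_induce_lt (v := ⟨u, self_mem_branch hu.ne'⟩) hr hu.symm
    have h2 := h.2.2 u hu.ne'
    exact Nat.le_sub_one_of_lt (h1.trans_le h2)
  · exact (deg_induce_le _ v).trans (h.2.2 v (ne_of_mem_branch v.2))

/-- Isomorphism classes of planted `Δ`-trees of arbitrary order. -/
abbrev Planted (Δ : ℕ) : Type := Σ n, PClass Δ n

namespace Planted

variable {Δ : ℕ}

/-- The underlying graph of a representative. -/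
noncomputable def graph (a : Planted Δ) : SimpleGraph (Fin a.1) := a.2.out.1.1

/-- The root of a representative. -/
noncomputable def root (a : Planted Δ) : Fin a.1 := a.2.out.1.2

/-- The number of neighbours of the root. -/
noncomputable def rdeg (a : Planted Δ) : ℕ := deg a.graph a.root

lemma isPlanted (a : Planted Δ) : IsPlanted Δ a.graph a.root := a.2.out.2

lemma mk_eq_mk {n m : ℕ} {p : PTree Δ n} {q : PTree Δ m} (φ : p.1.1 ≃g q.1.1)
    (hφ : φ p.1.2 = q.1.2) : (⟨n, ⟦p⟧⟩ : Planted Δ) = ⟨m, ⟦q⟧⟩ := by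
  obtain rfl : n = m := by simpa using Nat.card_congr φ.toEquiv
  exact congrArg _ (Quotient.sound ⟨φ, hφ⟩)

lemma ext_of_iso {a b : Planted Δ} (φ : a.graph ≃g b.graph) (hφ : φ a.root = b.root) : a = b := by
  have h := mk_eq_mk φ hφ
  rwa [Quotient.out_eq, Quotient.out_eq] at h

lemma exists_of_isPlanted {V : Type} [Finite V] {G : SimpleGraph V} {r : V}
    (h : IsPlanted Δ G r) : ∃ a : Planted Δ, ∃ φ : a.graph ≃g G, φ a.root = r := by
  let φ : G.comap (Finite.equivFin V).symm ≃g G := SimpleGraph.Iso.comap (Finite.equivFin V).symm G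
  let p : PTree Δ (Nat.card V) :=
    ⟨(G.comap (Finite.equivFin V).symm, φ.symm r), h.of_iso φ.symm rfl⟩
  obtain ⟨ψ, hψ⟩ : (⟦p⟧ : PClass Δ _).out ≈ p := Quotient.mk_out p
  exact ⟨⟨_, ⟦p⟧⟩, ψ.trans φ, (congrArg φ hψ).trans (φ.apply_symm_apply r)⟩

lemma isPlanted_graft (hΔ : 1 ≤ Δ) {I : Type} [Finite I] (c : I → Planted Δ)
    (hI : Nat.card I ≤ Δ - 1) :
    IsPlanted Δ (graft (fun i => (c i).graph) fun i => (c i).root) none := by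
  classical
  refine ⟨graft_isTree fun i => (c i).isPlanted.1, deg_graft_none.trans_le hI, ?_⟩
  rintro (_ | ⟨i, a⟩) h
  · exact (h rfl).elim
  · rw [deg_graft_some]
    split_ifs with h'
    · have h1 : a = (c i).root := by simpa using h'
      have h2 := (c i).isPlanted.2.1
      rw [h1]
      omega
    · have h1 : a ≠ (c i).root := by simpa using h'
      exact (c i).isPlanted.2.2 a h1

lemma exists_join (hΔ : 1 ≤ Δ) (M : {M : Multiset (Planted Δ) // M.card ≤ Δ - 1}) :
    ∃ a : Planted Δ, ∃ φ : a.graph ≃g graft (fun i : Fin M.1.toList.length =>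
      (M.1.toList.get i).graph) (fun i => (M.1.toList.get i).root), φ a.root = none :=
  exists_of_isPlanted (isPlanted_graft hΔ (fun i : Fin M.1.toList.length => M.1.toList.get i)
    (by simpa using M.2))

lemma map_get_toList {α : Type} (M : Multiset α) :
    (Finset.univ : Finset (Fin M.toList.length)).val.map (fun i => M.toList.get i) = M := by
  rw [Fin.univ_val_map, List.ofFn_get, Multiset.coe_toList]

lemma exists_equiv_of_map_eq {α I J : Type} [Fintype I] [Fintype J] {c : I → α} {d : J → α}
    (h : (Finset.univ : Finset I).val.map c = (Finset.univ : Finset J).val.map d) :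
    ∃ σ : I ≃ J, ∀ i, d (σ i) = c i := by
  classical
  have key : ∀ x, Nonempty ({i // c i = x} ≃ {j // d j = x}) := by
    intro x
    have h1 := congrArg (Multiset.count x) h
    rw [Multiset.count_map, Multiset.count_map] at h1
    refine ⟨Fintype.equivOfCardEq ?_⟩
    rw [Fintype.card_subtype, Fintype.card_subtype]
    simpa [Finset.card_def, eq_comm] using h1
  exact ⟨Equiv.ofFiberEquiv fun x => (key x).some, fun i => Equiv.ofFiberEquiv_map _ i⟩

/-- The tree whose branches at the root are the members of a multiset of planted trees. -/
noncomputable def join (hΔ : 1 ≤ Δ) (M : {M : Multiset (Planted Δ) // M.card ≤ Δ - 1}) :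
    Planted Δ := (exists_join hΔ M).choose

lemma join_spec (hΔ : 1 ≤ Δ) (M : {M : Multiset (Planted Δ) // M.card ≤ Δ - 1}) :
    ∃ φ : (join hΔ M).graph ≃g graft (fun i : Fin M.1.toList.length =>
      (M.1.toList.get i).graph) (fun i => (M.1.toList.get i).root), φ (join hΔ M).root = none :=
  (exists_join hΔ M).choose_spec

lemma rdeg_join (hΔ : 1 ≤ Δ) (M : {M : Multiset (Planted Δ) // M.card ≤ Δ - 1}) :
    (join hΔ M).rdeg = M.1.card := by
  obtain ⟨φ, hφ⟩ := join_spec hΔ M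
  rw [rdeg, ← deg_iso φ, hφ, deg_graft_none]
  simp

lemma order_join (hΔ : 1 ≤ Δ) (M : {M : Multiset (Planted Δ) // M.card ≤ Δ - 1}) :
    (join hΔ M).1 = 1 + (M.1.map Sigma.fst).sum := by
  obtain ⟨φ, hφ⟩ := join_spec hΔ M
  have h := Fintype.card_congr φ.toEquiv
  rw [Fintype.card_fin, Fintype.card_option, Fintype.card_sigma] at h
  rw [h, add_comm]
  conv_rhs => rw [← map_get_toList M.1]
  simp only [Multiset.map_map, Fintype.card_fin]
  rfl

lemma join_injective (hΔ : 1 ≤ Δ) : Function.Injective (join hΔ) := by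
  intro M N h
  obtain ⟨φ, hφ⟩ := join_spec hΔ M
  obtain ⟨ψ, hψ⟩ : ∃ ψ : (join hΔ M).graph ≃g graft (fun i : Fin N.1.toList.length =>
      (N.1.toList.get i).graph) (fun i => (N.1.toList.get i).root),
      ψ (join hΔ M).root = none := by
    rw [h]
    exact join_spec hΔ N
  obtain ⟨σ, hσ⟩ := exists_equiv_of_graft_iso (fun i => (M.1.toList.get i).isPlanted.1.connected)
    (fun i => (N.1.toList.get i).isPlanted.1.connected) (φ.symm.trans ψ)
    (by rw [← hφ]; simpa using hψ)
  refine Subtype.ext ?_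
  rw [← map_get_toList M.1, ← map_get_toList N.1, ← Multiset.map_univ_val_equiv σ,
    Multiset.map_map]
  refine Multiset.map_congr rfl fun i _ => ?_
  obtain ⟨χ, hχ⟩ := hσ i
  exact ext_of_iso χ hχ

lemma join_surjective (hΔ : 1 ≤ Δ) : Function.Surjective (join hΔ) := by
  classical
  intro a
  choose d hd using fun u : a.graph.neighborSet a.root =>
    exists_of_isPlanted (a.isPlanted.branch u.2)
  let M : Multiset (Planted Δ) := (Finset.univ : Finset (a.graph.neighborSet a.root)).val.map d
  have hM : M.card ≤ Δ - 1 := by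
    rw [Multiset.card_map, Finset.card_val, Finset.card_univ, ← Nat.card_eq_fintype_card]
    exact a.isPlanted.2.1
  refine ⟨⟨M, hM⟩, ?_⟩
  obtain ⟨φ, hφ⟩ := join_spec hΔ ⟨M, hM⟩
  obtain ⟨σ, hσ⟩ := exists_equiv_of_map_eq (map_get_toList M)
  have key : ∀ i, ∃ χ : (M.toList.get i).graph ≃g
      a.graph.induce (TreePaper.branch a.graph a.root (σ i)),
      (χ (M.toList.get i).root).1 = σ i := by
    intro i
    rw [← hσ]
    obtain ⟨χ, hχ⟩ := hd (σ i)
    exact ⟨χ, congrArg Subtype.val hχ⟩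
  choose χ hχ using key
  obtain ⟨ψ, hψ⟩ := exists_graft_iso a.isPlanted.1 σ χ hχ
  exact ext_of_iso (φ.trans ψ) ((congrArg ψ hφ).trans hψ)

/-- A planted tree amounts to the multiset of its branches at the root. -/
noncomputable def joinEquiv (hΔ : 1 ≤ Δ) :
    {M : Multiset (Planted Δ) // M.card ≤ Δ - 1} ≃ Planted Δ :=
  Equiv.ofBijective (join hΔ) ⟨join_injective hΔ, join_surjective hΔ⟩

end Planted

end trees

section symmetricSums

open scoped ENNReal

variable {α : Type}

/-- The complete homogeneous symmetric sum of degree `k` of a family of weights. -/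
noncomputable def hsum (w : α → ℝ≥0∞) (k : ℕ) : ℝ≥0∞ :=
  ∑' M : Multiset α, if M.card = k then (M.map w).prod else 0

/-- The power sum of degree `j` of a family of weights. -/
noncomputable def powerSum (w : α → ℝ≥0∞) (j : ℕ) : ℝ≥0∞ := ∑' a, w a ^ j

lemma hsum_zero (w : α → ℝ≥0∞) : hsum w 0 = 1 := by
  rw [hsum, tsum_eq_single 0]
  · simp
  · intro M hM
    rw [if_neg (by simpa using hM)]

lemma tsum_count [DecidableEq α] (M : Multiset α) :
    ∑' a, (M.count a : ℝ≥0∞) = M.card := by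
  rw [tsum_eq_sum (s := M.toFinset)]
  · exact_mod_cast M.toFinset_sum_count_eq
  · intro a ha
    simpa using ha

lemma tsum_count_ge [DecidableEq α] (w : α → ℝ≥0∞) (a : α) {j k : ℕ} (hj : j ≤ k) :
    (∑' M : Multiset α, if M.card = k ∧ j ≤ M.count a then (M.map w).prod else 0) =
      w a ^ j * hsum w (k - j) := by
  have hinj : Function.Injective fun M : Multiset α => M + Multiset.replicate j a :=
    add_left_injective _
  rw [← hinj.tsum_eq, hsum, ← ENNReal.tsum_mul_left]
  · refine tsum_congr fun M => ?_
    have h1 : M.card + j = k ↔ M.card = k - j := by omega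
    by_cases h : M.card = k - j
    · have h' := h1.2 h
      simp [h, hj, mul_comm]
    · simp [h1, h]
  · intro M hM
    have h : M.card = k ∧ j ≤ M.count a := by
      by_contra h
      simp [h] at hM
    exact ⟨M - Multiset.replicate j a,
      tsub_add_cancel_of_le (Multiset.le_count_iff_replicate_le.1 h.2)⟩

/-- Newton's identities for complete homogeneous symmetric sums. -/
lemma newton_hsum (w : α → ℝ≥0∞) (k : ℕ) :
    (k + 1 : ℝ≥0∞) * hsum w (k + 1) =
      ∑ j ∈ Finset.range (k + 1), powerSum w (j + 1) * hsum w (k - j) := by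
  classical
  have h1 : ∀ j ∈ Finset.range (k + 1), powerSum w (j + 1) * hsum w (k - j) =
      ∑' M : Multiset α, ∑' a, if M.card = k + 1 ∧ j + 1 ≤ M.count a then (M.map w).prod else 0 := by
    intro j hj
    rw [Finset.mem_range] at hj
    rw [ENNReal.tsum_comm, powerSum, ← ENNReal.tsum_mul_right]
    refine tsum_congr fun a => ?_
    rw [tsum_count_ge w a (by omega : j + 1 ≤ k + 1)]
    congr 2
    omega
  rw [Finset.sum_congr rfl h1, hsum, ← ENNReal.tsum_mul_left,
    ← Summable.tsum_finsetSum fun _ _ => ENNReal.summable]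
  refine tsum_congr fun M => ?_
  rw [← Summable.tsum_finsetSum fun _ _ => ENNReal.summable]
  by_cases hM : M.card = k + 1
  · simp only [hM, true_and, if_true]
    have h2 : ∀ a, (∑ j ∈ Finset.range (k + 1),
        if j + 1 ≤ M.count a then (M.map w).prod else 0) = M.count a * (M.map w).prod := by
      intro a
      rw [← Finset.sum_filter, Finset.sum_const, nsmul_eq_mul]
      congr 2
      have h3 : (Finset.range (k + 1)).filter (fun j => j + 1 ≤ M.count a) =
          Finset.range (M.count a) := by
        ext j
        have := M.count_le_card a
        simp only [Finset.mem_filter, Finset.mem_range]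
        omega
      rw [h3, Finset.card_range]
    simp only [h2]
    rw [ENNReal.tsum_mul_right, tsum_count, hM]
    push_cast
    rfl
  · simp [hM]

/-- The sequence determined from power sums by Newton's identities; `c i` plays the role of the
power sum of degree `i + 1`. -/
noncomputable def newtonSeq (c : ℕ → ℝ) : ℕ → ℝ
  | 0 => 1
  | k + 1 => (∑ i : Fin (k + 1), c i * newtonSeq c (k - i)) / (k + 1)

lemma newtonSeq_zero (c : ℕ → ℝ) : newtonSeq c 0 = 1 := by rw [newtonSeq]

lemma newtonSeq_succ (c : ℕ → ℝ) (k : ℕ) :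
    (k + 1) * newtonSeq c (k + 1) = ∑ i ∈ Finset.range (k + 1), c i * newtonSeq c (k - i) := by
  rw [newtonSeq, mul_div_cancel₀ _ (by positivity),
    Fin.sum_univ_eq_sum_range fun i => c i * newtonSeq c (k - i)]

lemma newtonSeq_nonneg {c : ℕ → ℝ} (hc : ∀ i, 0 ≤ c i) (k : ℕ) : 0 ≤ newtonSeq c k := by
  induction k using Nat.strong_induction_on with
  | _ k ih =>
    cases k with
    | zero => simp [newtonSeq_zero]
    | succ k =>
      rw [newtonSeq]
      exact div_nonneg (Finset.sum_nonneg fun i _ => mul_nonneg (hc _) (ih _ (by omega)))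
        (by positivity)

lemma newtonSeq_mono {c d : ℕ → ℝ} (hc : ∀ i, 0 ≤ c i) (hcd : ∀ i, c i ≤ d i) (k : ℕ) :
    newtonSeq c k ≤ newtonSeq d k := by
  induction k using Nat.strong_induction_on with
  | _ k ih =>
    cases k with
    | zero => simp [newtonSeq_zero]
    | succ k =>
      rw [newtonSeq, newtonSeq]
      gcongr with i _
      · exact newtonSeq_nonneg hc _
      · exact (hc _).trans (hcd _)
      · exact hcd _
      · exact ih _ (by omega)

lemma newtonSeq_one (c : ℕ → ℝ) : newtonSeq c 1 = c 0 := by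
  simp [newtonSeq]

lemma continuousAt_newtonSeq {X : Type} [TopologicalSpace X] {c : X → ℕ → ℝ} {x : X}
    (hc : ∀ i, ContinuousAt (fun x => c x i) x) (k : ℕ) :
    ContinuousAt (fun x => newtonSeq (c x) k) x := by
  induction k using Nat.strong_induction_on with
  | _ k ih =>
    cases k with
    | zero => simpa [newtonSeq_zero] using continuousAt_const
    | succ k =>
      simp only [newtonSeq]
      exact (tendsto_finsetSum _ fun i _ => (hc _).mul (ih _ (by omega))).div_const _

lemma hsum_eq_ofReal {w : α → ℝ≥0∞} {c : ℕ → ℝ} (hc : ∀ i, 0 ≤ c i)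
    (hw : ∀ i, powerSum w (i + 1) = ENNReal.ofReal (c i)) (k : ℕ) :
    hsum w k = ENNReal.ofReal (newtonSeq c k) := by
  induction k using Nat.strong_induction_on with
  | _ k ih =>
    cases k with
    | zero => simp [newtonSeq_zero, hsum_zero]
    | succ k =>
      have h0 : ((k : ℝ≥0∞) + 1) ≠ 0 := by simp
      have ht : ((k : ℝ≥0∞) + 1) ≠ ∞ := by simp
      have hk : ((k : ℝ≥0∞) + 1) = ENNReal.ofReal (k + 1) := by
        rw [ENNReal.ofReal_add (by positivity) zero_le_one]
        simp
      rw [← ENNReal.mul_right_inj h0 ht, newton_hsum, hk, ← ENNReal.ofReal_mul (by positivity),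
        newtonSeq_succ, ENNReal.ofReal_sum_of_nonneg fun i _ =>
          mul_nonneg (hc _) (newtonSeq_nonneg hc _)]
      refine Finset.sum_congr rfl fun i _ => ?_
      rw [hw, ih _ (by omega), ENNReal.ofReal_mul (hc _)]

lemma newtonSeq_update_succ (c : ℕ → ℝ) (y : ℝ) (k : ℕ) :
    (k + 1) * newtonSeq (Function.update c 0 y) (k + 1) =
      ∑ i ∈ Finset.range k, c (i + 1) * newtonSeq (Function.update c 0 y) (k - (i + 1)) +
        y * newtonSeq (Function.update c 0 y) k := by
  rw [newtonSeq_succ, Finset.sum_range_succ']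
  simp

lemma update_zero_nonneg {c : ℕ → ℝ} (hc : ∀ i, 0 ≤ c i) {y : ℝ} (hy : 0 ≤ y) (i : ℕ) :
    0 ≤ Function.update c 0 y i := by
  rcases i with _ | i
  · simpa using hy
  · simpa using hc _

lemma newtonSeq_update_mono {c : ℕ → ℝ} (hc : ∀ i, 0 ≤ c i) {y z : ℝ} (hy : 0 ≤ y) (hyz : y ≤ z)
    (k : ℕ) : newtonSeq (Function.update c 0 y) k ≤ newtonSeq (Function.update c 0 z) k := by
  refine newtonSeq_mono (update_zero_nonneg hc hy) (fun i => ?_) k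
  rcases i with _ | i
  · simpa using hyz
  · simp

/-- The tangent line inequality for `newtonSeq` as a function of the first power sum. -/
lemma newtonSeq_update_ge {c : ℕ → ℝ} (hc : ∀ i, 0 ≤ c i) {y z : ℝ} (hy : 0 ≤ y) (hz : 0 ≤ z)
    (k : ℕ) : newtonSeq (Function.update c 0 y) (k + 1) +
      (z - y) * newtonSeq (Function.update c 0 y) k ≤
        newtonSeq (Function.update c 0 z) (k + 1) := by
  induction k using Nat.strong_induction_on with
  | _ k ih =>
    cases k with
    | zero => simp [newtonSeq_one, newtonSeq_zero]
    | succ m =>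
      have hg := newtonSeq_update_succ c z (m + 1)
      have hh := newtonSeq_update_succ c y (m + 1)
      have hh' := newtonSeq_update_succ c y m
      have ihm := ih m (by omega)
      have hd : 0 ≤ (z - y) * (newtonSeq (Function.update c 0 z) (m + 1) -
          newtonSeq (Function.update c 0 y) (m + 1)) := by
        rcases le_total y z with h | h
        · exact mul_nonneg (sub_nonneg.2 h) (sub_nonneg.2 (newtonSeq_update_mono hc hy h _))
        · exact mul_nonneg_of_nonpos_of_nonpos (sub_nonpos.2 h)
            (sub_nonpos.2 (newtonSeq_update_mono hc hz h _))
      set h := newtonSeq (Function.update c 0 y)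
      set g := newtonSeq (Function.update c 0 z)
      have hS : ∑ i ∈ Finset.range (m + 1), c (i + 1) * h (m + 1 - (i + 1)) +
          (z - y) * ∑ i ∈ Finset.range m, c (i + 1) * h (m - (i + 1)) ≤
          ∑ i ∈ Finset.range (m + 1), c (i + 1) * g (m + 1 - (i + 1)) := by
        rw [Finset.sum_range_succ, Finset.sum_range_succ _ m, Finset.mul_sum, add_right_comm,
          ← Finset.sum_add_distrib]
        refine add_le_add (Finset.sum_le_sum fun i hi => ?_) (by simp [h, g, newtonSeq_zero])
        rw [Finset.mem_range] at hi
        have h1 := mul_le_mul_of_nonneg_left (ih (m - (i + 1)) (by omega)) (hc (i + 1))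
        have h2 : m - (i + 1) + 1 = m + 1 - (i + 1) := by omega
        rw [h2] at h1
        linarith
      have hy' := mul_le_mul_of_nonneg_left ihm hy
      push_cast at hg hh
      have hm : (0 : ℝ) < m + 2 := by positivity
      rw [← mul_le_mul_iff_right₀ hm]
      have e1 : ∑ i ∈ Finset.range m, c (i + 1) * h (m - (i + 1)) =
        (m + 1) * h (m + 1) - y * h m := by linarith
      rw [e1] at hS
      simp only [Nat.add_sub_add_right] at hg hh hS
      nlinarith

end symmetricSums

section planted

open scoped ENNReal

variable {Δ : ℕ}

lemma tsum_planted_eq (hΔ : 1 ≤ Δ) (f : Planted Δ → ℝ≥0∞) (g : Multiset (Planted Δ) → ℝ≥0∞)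
    (hfg : ∀ M, f (Planted.join hΔ M) = g M.1) :
    ∑' a, f a = ∑' M : Multiset (Planted Δ), if M.card ≤ Δ - 1 then g M else 0 := by
  rw [← (Planted.joinEquiv hΔ).tsum_eq]
  have h := tsum_subtype {M : Multiset (Planted Δ) | M.card ≤ Δ - 1} g
  simp only [Set.indicator_apply, Set.mem_ofPred_eq] at h
  rw [← h]
  exact tsum_congr fun M => hfg M

lemma prod_map_pow_order (x : ℝ≥0∞) (M : Multiset (Planted Δ)) :
    (M.map fun a => x ^ a.1).prod = x ^ (M.map Sigma.fst).sum := by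
  induction M using Multiset.induction_on with
  | empty => simp
  | cons a M ih => simp [ih, pow_add]

lemma sum_hsum {α : Type} (w : α → ℝ≥0∞) (d : ℕ) :
    ∑ k ∈ Finset.range d, hsum w k =
      ∑' M : Multiset α, if M.card < d then (M.map w).prod else 0 := by
  simp only [hsum]
  rw [← Summable.tsum_finsetSum fun _ _ => ENNReal.summable]
  refine tsum_congr fun M => ?_
  rw [Finset.sum_ite_eq]
  simp

/-- The functional equation for planted trees whose root has fewer than `d` neighbours. -/
lemma tsum_order_eq (hΔ : 1 ≤ Δ) {d : ℕ} (hd : d ≤ Δ) (x : ℝ≥0∞) :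
    (∑' a : Planted Δ, if a.rdeg < d then x ^ a.1 else 0) =
      x * ∑ k ∈ Finset.range d, hsum (fun a : Planted Δ => x ^ a.1) k := by
  rw [sum_hsum, ← ENNReal.tsum_mul_left, tsum_planted_eq hΔ _
    (fun M => if M.card < d then x * (M.map fun a => x ^ a.1).prod else 0)]
  · refine tsum_congr fun M => ?_
    by_cases h : M.card < d
    · have h' : M.card ≤ Δ - 1 := by omega
      simp [h, h']
    · simp [h]
  · intro M
    rw [Planted.rdeg_join, Planted.order_join, prod_map_pow_order, pow_add, pow_one]

/-- A recursive bound for the truncations of the series of planted trees. -/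
lemma tsum_order_le (hΔ : 1 ≤ Δ) (x : ℝ≥0∞) (N : ℕ) :
    (∑' a : Planted Δ, if a.1 ≤ N + 1 then x ^ a.1 else 0) ≤
      x * ∑ k ∈ Finset.range Δ, hsum (fun a : Planted Δ => if a.1 ≤ N then x ^ a.1 else 0) k := by
  rw [sum_hsum, ← ENNReal.tsum_mul_left, tsum_planted_eq hΔ _
    (fun M => if 1 + (M.map Sigma.fst).sum ≤ N + 1 then x ^ (1 + (M.map Sigma.fst).sum) else 0)]
  · refine ENNReal.tsum_le_tsum fun M => ?_
    by_cases h : M.card ≤ Δ - 1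
    · have h' : M.card < Δ := by omega
      rw [if_pos h, if_pos h']
      split_ifs with hN
      · rw [pow_add, pow_one, ← prod_map_pow_order]
        refine le_of_eq (congrArg _ (congrArg _ (Multiset.map_congr rfl fun a ha => ?_)))
        have := Multiset.single_le_sum (fun _ _ => Nat.zero_le _) _
          (Multiset.mem_map_of_mem Sigma.fst ha)
        rw [if_pos (by omega)]
      · exact zero_le
    · rw [if_neg h]
      exact zero_le
  · intro M
    rw [Planted.order_join]

instance (n : ℕ) : Finite (PClass Δ n) := Quotient.finite _

lemma tsum_planted_eq_tsum_pTotal (x : ℝ≥0∞) :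
    ∑' a : Planted Δ, x ^ a.1 = ∑' n, (pTotal Δ n : ℝ≥0∞) * x ^ n := by
  rw [ENNReal.tsum_sigma' fun a : Planted Δ => x ^ a.1]
  refine tsum_congr fun n => ?_
  have := Fintype.ofFinite (PClass Δ n)
  dsimp only
  rw [tsum_fintype, Finset.sum_const, nsmul_eq_mul, Finset.card_univ, pTotal,
    Nat.card_eq_fintype_card]

lemma tsum_planted_eq_tsum_pResTotal (hΔ : 2 ≤ Δ) (x : ℝ≥0∞) :
    (∑' a : Planted Δ, if a.rdeg < Δ - 1 then x ^ a.1 else 0) =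
      ∑' n, (pResTotal Δ n : ℝ≥0∞) * x ^ n := by
  classical
  rw [ENNReal.tsum_sigma' fun a : Planted Δ => if a.rdeg < Δ - 1 then x ^ a.1 else 0]
  refine tsum_congr fun n => ?_
  have := Fintype.ofFinite (PClass Δ n)
  dsimp only
  rw [tsum_fintype, ← Finset.sum_filter, Finset.sum_const, nsmul_eq_mul, pResTotal,
    Nat.card_eq_fintype_card, Fintype.card_subtype]
  congr 4
  ext c
  change degr (Quotient.out c).1.1 (Quotient.out c).1.2 < Δ - 1 ↔
    degr (Quotient.out c).1.1 (Quotient.out c).1.2 ≤ Δ - 2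
  omega

end planted

section analysis

open scoped ENNReal

variable {Δ : ℕ}

lemma tsum_mul_pow_eq_ofReal {a : ℕ → ℕ} {x : ℝ} (hx : 0 ≤ x)
    (h : Summable fun n => (a n : ℝ) * x ^ n) :
    ∑' n, (a n : ℝ≥0∞) * ENNReal.ofReal x ^ n = ENNReal.ofReal (∑' n, (a n : ℝ) * x ^ n) := by
  rw [ENNReal.ofReal_tsum_of_nonneg (fun n => by positivity) h]
  refine tsum_congr fun n => ?_
  rw [ENNReal.ofReal_mul (by positivity), ENNReal.ofReal_natCast, ENNReal.ofReal_pow hx]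

lemma summable_mul_pow_of_ne_top {a : ℕ → ℕ} {x : ℝ} (hx : 0 ≤ x)
    (h : ∑' n, (a n : ℝ≥0∞) * ENNReal.ofReal x ^ n ≠ ∞) :
    Summable fun n => (a n : ℝ) * x ^ n := by
  refine (ENNReal.summable_toReal h).congr fun n => ?_
  simp [ENNReal.toReal_ofReal hx]

lemma summable_mul_pow_mono {a : ℕ → ℕ} {x z : ℝ} (hx : 0 ≤ x) (hxz : x ≤ z)
    (h : Summable fun n => (a n : ℝ) * z ^ n) : Summable fun n => (a n : ℝ) * x ^ n :=
  h.of_nonneg_of_le (fun n => by positivity) fun n => by gcongr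

lemma tsum_mul_pow_mono {a : ℕ → ℕ} {x z : ℝ} (hx : 0 ≤ x) (hxz : x ≤ z)
    (h : Summable fun n => (a n : ℝ) * z ^ n) :
    ∑' n, (a n : ℝ) * x ^ n ≤ ∑' n, (a n : ℝ) * z ^ n :=
  (summable_mul_pow_mono hx hxz h).tsum_le_tsum (fun n => by gcongr) h

lemma continuousAt_tsum_mul_pow {a : ℕ → ℕ} {x z : ℝ} (hx : 0 < x) (hxz : x < z)
    (h : Summable fun n => (a n : ℝ) * z ^ n) :
    ContinuousAt (fun x : ℝ => ∑' n, (a n : ℝ) * x ^ n) x := by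
  have hc : ContinuousOn (fun x : ℝ => ∑' n, (a n : ℝ) * x ^ n) (Set.Icc 0 z) := by
    refine continuousOn_tsum (fun n => by fun_prop) h fun n y hy => ?_
    have := hy.1
    rw [Real.norm_of_nonneg (by positivity)]
    gcongr
    exact hy.2
  exact hc.continuousAt (Icc_mem_nhds hx hxz)

/-- The generating function of planted trees. -/
noncomputable def plantedGF (Δ : ℕ) (x : ℝ) : ℝ := ∑' n, (pTotal Δ n : ℝ) * x ^ n

/-- The values of the generating function of planted trees at the powers of `x`. -/
noncomputable def powerGF (Δ : ℕ) (x : ℝ) (i : ℕ) : ℝ := plantedGF Δ (x ^ (i + 1))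

lemma plantedGF_nonneg {x : ℝ} (hx : 0 ≤ x) : 0 ≤ plantedGF Δ x :=
  tsum_nonneg fun n => by positivity

lemma powerGF_nonneg {x : ℝ} (hx : 0 ≤ x) (i : ℕ) : 0 ≤ powerGF Δ x i :=
  plantedGF_nonneg (by positivity)

lemma update_powerGF (x : ℝ) :
    Function.update (powerGF Δ x) 0 (plantedGF Δ x) = powerGF Δ x := by
  rw [Function.update_eq_self_iff]
  simp [powerGF]

/-- The right-hand side of the functional equation for trees whose root has fewer than `d`
neighbours, in terms of the power sums. -/
noncomputable def newtonSum (d : ℕ) (x : ℝ) (c : ℕ → ℝ) : ℝ :=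
  x * ∑ k ∈ Finset.range d, newtonSeq c k

lemma newtonSum_mono {d : ℕ} {x z : ℝ} {b c : ℕ → ℝ} (hx : 0 ≤ x) (hxz : x ≤ z)
    (hb : ∀ i, 0 ≤ b i) (hbc : ∀ i, b i ≤ c i) : newtonSum d x b ≤ newtonSum d z c := by
  have h := Finset.sum_le_sum fun k (_ : k ∈ Finset.range d) => newtonSeq_mono hb hbc k
  have h0 : 0 ≤ ∑ k ∈ Finset.range d, newtonSeq b k :=
    Finset.sum_nonneg fun k _ => newtonSeq_nonneg hb k
  exact mul_le_mul hxz h h0 (hx.trans hxz)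

lemma le_newtonSum {d : ℕ} (hd : 2 ≤ d) {x : ℝ} (hx : 0 ≤ x) {c : ℕ → ℝ} (hc : ∀ i, 0 ≤ c i) :
    x * (1 + c 0) ≤ newtonSum d x c := by
  refine mul_le_mul_of_nonneg_left ?_ hx
  have h := Finset.sum_le_sum_of_subset_of_nonneg (Finset.range_mono hd)
    fun k _ _ => newtonSeq_nonneg hc k
  simpa [Finset.sum_range_succ, newtonSeq_zero, newtonSeq_one] using h

lemma newtonSum_tangent {d : ℕ} {x : ℝ} (hx : 0 ≤ x) {c : ℕ → ℝ} (hc : ∀ i, 0 ≤ c i) {y z : ℝ}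
    (hy : 0 ≤ y) (hz : 0 ≤ z) :
    newtonSum (d + 1) x (Function.update c 0 y) +
      (z - y) * newtonSum d x (Function.update c 0 y) ≤
        newtonSum (d + 1) x (Function.update c 0 z) := by
  have h := Finset.sum_le_sum fun k (_ : k ∈ Finset.range d) => newtonSeq_update_ge hc hy hz k
  rw [Finset.sum_add_distrib, ← Finset.mul_sum] at h
  have h' := mul_le_mul_of_nonneg_left h hx
  rw [newtonSum, newtonSum, newtonSum, Finset.sum_range_succ', Finset.sum_range_succ',
    newtonSeq_zero, newtonSeq_zero]
  linarith

lemma continuousAt_newtonSum {X : Type} [TopologicalSpace X] {f : X → ℝ} {c : X → ℕ → ℝ} {x : X}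
    (hf : ContinuousAt f x) (hc : ∀ i, ContinuousAt (fun x => c x i) x) (d : ℕ) :
    ContinuousAt (fun x => newtonSum d (f x) (c x)) x :=
  hf.mul (tendsto_finsetSum _ fun k _ => continuousAt_newtonSeq hc k)

lemma powerSum_order_eq {x : ℝ} (hx : 0 ≤ x) {i : ℕ}
    (h : Summable fun n => (pTotal Δ n : ℝ) * (x ^ (i + 1)) ^ n) :
    powerSum (fun a : Planted Δ => ENNReal.ofReal x ^ a.1) (i + 1) =
      ENNReal.ofReal (powerGF Δ x i) := by
  rw [powerGF, plantedGF, ← tsum_mul_pow_eq_ofReal (by positivity) h,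
    ← tsum_planted_eq_tsum_pTotal, powerSum]
  refine tsum_congr fun a => ?_
  rw [ENNReal.ofReal_pow hx, pow_right_comm]

lemma hsum_order_eq {x : ℝ} (hx : 0 ≤ x) (hx1 : x ≤ 1)
    (h : Summable fun n => (pTotal Δ n : ℝ) * x ^ n) (k : ℕ) :
    hsum (fun a : Planted Δ => ENNReal.ofReal x ^ a.1) k =
      ENNReal.ofReal (newtonSeq (powerGF Δ x) k) :=
  hsum_eq_ofReal (powerGF_nonneg hx) (fun i => powerSum_order_eq hx
    (summable_mul_pow_mono (by positivity) (pow_le_of_le_one hx hx1 (by simp)) h)) k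

lemma newtonSum_nonneg {d : ℕ} {x : ℝ} (hx : 0 ≤ x) {c : ℕ → ℝ} (hc : ∀ i, 0 ≤ c i) :
    0 ≤ newtonSum d x c :=
  mul_nonneg hx (Finset.sum_nonneg fun k _ => newtonSeq_nonneg hc k)

lemma mul_sum_ofReal {d : ℕ} {x : ℝ} (hx : 0 ≤ x) {c : ℕ → ℝ} (hc : ∀ i, 0 ≤ c i) :
    ENNReal.ofReal x * ∑ k ∈ Finset.range d, ENNReal.ofReal (newtonSeq c k) =
      ENNReal.ofReal (newtonSum d x c) := by
  rw [← ENNReal.ofReal_sum_of_nonneg fun k _ => newtonSeq_nonneg hc k, ← ENNReal.ofReal_mul hx,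
    newtonSum]

lemma tsum_eq_newtonSum (hΔ : 1 ≤ Δ) {d : ℕ} (hd : d ≤ Δ) {x : ℝ} (hx : 0 ≤ x) (hx1 : x ≤ 1)
    (h : Summable fun n => (pTotal Δ n : ℝ) * x ^ n) :
    (∑' a : Planted Δ, if a.rdeg < d then ENNReal.ofReal x ^ a.1 else 0) =
      ENNReal.ofReal (newtonSum d x (powerGF Δ x)) := by
  rw [tsum_order_eq hΔ hd, ← mul_sum_ofReal hx (powerGF_nonneg hx)]
  exact congrArg _ (Finset.sum_congr rfl fun k _ => hsum_order_eq hx hx1 h k)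

lemma plantedGF_eq (hΔ : 1 ≤ Δ) {x : ℝ} (hx : 0 ≤ x) (hx1 : x ≤ 1)
    (h : Summable fun n => (pTotal Δ n : ℝ) * x ^ n) :
    plantedGF Δ x = newtonSum Δ x (powerGF Δ x) := by
  have h1 := tsum_eq_newtonSum hΔ le_rfl hx hx1 h
  have h2 : ∀ a : Planted Δ, a.rdeg < Δ := fun a => by
    have := a.isPlanted.2.1
    change deg a.graph a.root < Δ
    omega
  simp only [h2, if_true] at h1
  rw [tsum_planted_eq_tsum_pTotal, tsum_mul_pow_eq_ofReal hx h] at h1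
  exact (ENNReal.ofReal_eq_ofReal_iff (plantedGF_nonneg hx)
    (newtonSum_nonneg hx (powerGF_nonneg hx))).1 h1

lemma pRes_eq (hΔ : 2 ≤ Δ) {x : ℝ} (hx : 0 ≤ x) (hx1 : x ≤ 1)
    (h : Summable fun n => (pTotal Δ n : ℝ) * x ^ n) :
    (Summable fun n => (pResTotal Δ n : ℝ) * x ^ n) ∧
      ∑' n, (pResTotal Δ n : ℝ) * x ^ n = newtonSum (Δ - 1) x (powerGF Δ x) := by
  have h1 := tsum_eq_newtonSum (by omega) (Nat.sub_le Δ 1) hx hx1 h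
  rw [tsum_planted_eq_tsum_pResTotal hΔ] at h1
  have hs := summable_mul_pow_of_ne_top hx (h1.trans_ne ENNReal.ofReal_ne_top)
  rw [tsum_mul_pow_eq_ofReal hx hs] at h1
  exact ⟨hs, (ENNReal.ofReal_eq_ofReal_iff (tsum_nonneg fun n => by positivity)
    (newtonSum_nonneg hx (powerGF_nonneg hx))).1 h1⟩

lemma summable_pTotal_of_pResTotal (hΔ : 3 ≤ Δ) {x : ℝ} (hx : 0 < x)
    (h : Summable fun n => (pResTotal Δ n : ℝ) * x ^ n) :
    Summable fun n => (pTotal Δ n : ℝ) * x ^ n := by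
  refine summable_mul_pow_of_ne_top hx.le ?_
  have h1 := tsum_order_eq (by omega) (Nat.sub_le Δ 1) (ENNReal.ofReal x)
  rw [tsum_planted_eq_tsum_pResTotal (by omega), tsum_mul_pow_eq_ofReal hx.le h] at h1
  have h2 : hsum (fun a : Planted Δ => ENNReal.ofReal x ^ a.1) 1 ≤
      ∑ k ∈ Finset.range (Δ - 1), hsum (fun a : Planted Δ => ENNReal.ofReal x ^ a.1) k :=
    Finset.single_le_sum (f := hsum fun a : Planted Δ => ENNReal.ofReal x ^ a.1)
      (fun _ _ => zero_le) (Finset.mem_range.2 (by omega))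
  have h3 := newton_hsum (fun a : Planted Δ => ENNReal.ofReal x ^ a.1) 0
  simp only [Nat.cast_zero, zero_add, one_mul, Finset.range_one, Finset.sum_singleton, powerSum,
    pow_one, hsum_zero, mul_one, tsum_planted_eq_tsum_pTotal, Nat.sub_self] at h3
  rw [← h3]
  refine ne_top_of_le_ne_top (fun htop => ?_) h2
  rw [htop, ENNReal.mul_top (by simpa using hx)] at h1
  exact ENNReal.ofReal_ne_top h1

/-- A supersolution of the functional equation forces convergence. -/
lemma summable_of_newtonSum_le (hΔ : 1 ≤ Δ) {x y : ℝ} (hx : 0 ≤ x) (hx1 : x ≤ 1) (hy : 0 ≤ y)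
    (h : Summable fun n => (pTotal Δ n : ℝ) * (x ^ 2) ^ n)
    (hxy : newtonSum Δ x (Function.update (powerGF Δ x) 0 y) ≤ y) :
    Summable fun n => (pTotal Δ n : ℝ) * x ^ n := by
  refine summable_mul_pow_of_ne_top hx ?_
  rw [← tsum_planted_eq_tsum_pTotal]
  have key : ∀ N, (∑' a : Planted Δ, if a.1 ≤ N then ENNReal.ofReal x ^ a.1 else 0) ≤
      ENNReal.ofReal y := by
    intro N
    induction N with
    | zero =>
      have h0 : ∀ a : Planted Δ, ¬ a.1 ≤ 0 := fun a => by
        have := a.root.pos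
        omega
      simp [h0]
    | succ N ih =>
      refine (tsum_order_le hΔ _ N).trans ?_
      set w : Planted Δ → ℝ≥0∞ := fun a => if a.1 ≤ N then ENNReal.ofReal x ^ a.1 else 0
      have hw : ∀ i, powerSum w (i + 1) ≤
          ENNReal.ofReal (Function.update (powerGF Δ x) 0 y i) := by
        rintro (_ | i)
        · simpa [powerSum] using ih
        · rw [Function.update_of_ne (by simp), ← powerSum_order_eq hx]
          · refine ENNReal.tsum_le_tsum fun a => pow_le_pow_left' ?_ _
            simp only [w]
            split_ifs
            · exact le_rfl
            · exact zero_le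
          · exact summable_mul_pow_mono (by positivity)
              (pow_le_pow_of_le_one hx hx1 (by omega)) h
      have hu := update_zero_nonneg (powerGF_nonneg (Δ := Δ) hx) hy
      have hw' : ∀ i, powerSum w (i + 1) = ENNReal.ofReal (powerSum w (i + 1)).toReal := fun i =>
        (ENNReal.ofReal_toReal (ne_top_of_le_ne_top ENNReal.ofReal_ne_top (hw i))).symm
      have hs := hsum_eq_ofReal (fun i => ENNReal.toReal_nonneg) hw'
      simp only [hs]
      rw [mul_sum_ofReal hx fun i => ENNReal.toReal_nonneg]
      refine ENNReal.ofReal_le_ofReal (le_trans ?_ hxy)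
      exact newtonSum_mono hx le_rfl (fun i => ENNReal.toReal_nonneg)
        fun i => ENNReal.toReal_le_of_le_ofReal (hu i) (hw i)
  refine ne_top_of_le_ne_top (ENNReal.ofReal_ne_top (r := y)) ?_
  rw [ENNReal.tsum_eq_iSup_sum]
  refine iSup_le fun s => le_trans ?_ (key (s.sup Sigma.fst))
  refine le_trans (Finset.sum_le_sum fun a ha => ?_) (ENNReal.sum_le_tsum s)
  rw [if_pos (Finset.le_sup (f := Sigma.fst) ha)]

/-- Inside the disc of convergence the restricted series is at most one. -/
lemma newtonSum_le_one (hΔ : 2 ≤ Δ) {x z : ℝ} (hx : 0 < x) (hxz : x < z) (hz : z ≤ 1)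
    (h : Summable fun n => (pTotal Δ n : ℝ) * z ^ n) :
    newtonSum (Δ - 1) x (powerGF Δ x) ≤ 1 := by
  obtain ⟨d, rfl⟩ : ∃ d, Δ = d + 1 := ⟨Δ - 1, by omega⟩
  have hxs := summable_mul_pow_mono hx.le hxz.le h
  have hz0 := hx.trans hxz
  have ex := plantedGF_eq (by omega) hx.le (hxz.le.trans hz) hxs
  have ez := plantedGF_eq (by omega) hz0.le hz h
  have hmono : ∀ i, powerGF (d + 1) x i ≤ powerGF (d + 1) z i := fun i =>
    tsum_mul_pow_mono (by positivity) (by gcongr)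
      (summable_mul_pow_mono (by positivity) (pow_le_of_le_one hz0.le hz (by simp)) h)
  have hle : plantedGF (d + 1) x ≤ plantedGF (d + 1) z := tsum_mul_pow_mono hx.le hxz.le h
  have hpos := le_newtonSum (by omega : 2 ≤ d + 1) hx.le (powerGF_nonneg (Δ := d + 1) hx.le)
  have hpx : 0 < newtonSum (d + 1) x (powerGF (d + 1) x) :=
    lt_of_lt_of_le (mul_pos hx (by linarith [powerGF_nonneg (Δ := d + 1) hx.le 0])) hpos
  have hlt : plantedGF (d + 1) x < plantedGF (d + 1) z := by
    have h1 := newtonSum_mono (d := d + 1) hz0.le le_rfl (powerGF_nonneg hx.le) hmono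
    rw [ex, ez]
    refine lt_of_lt_of_le ?_ h1
    refine mul_lt_mul_of_pos_right hxz ?_
    exact pos_of_mul_pos_right hpx hx.le
  have ht := newtonSum_tangent (d := d) hx.le (powerGF_nonneg (Δ := d + 1) hx.le)
    (plantedGF_nonneg (Δ := d + 1) hx.le) (plantedGF_nonneg (Δ := d + 1) hz0.le)
  rw [update_powerGF, ← ex] at ht
  have hu : newtonSum (d + 1) x (Function.update (powerGF (d + 1) x) 0 (plantedGF (d + 1) z)) ≤
      plantedGF (d + 1) z := by
    conv_rhs => rw [ez]
    rw [← update_powerGF (Δ := d + 1) z]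
    refine newtonSum_mono hx.le hxz.le
      (update_zero_nonneg (powerGF_nonneg hx.le) (plantedGF_nonneg hz0.le)) ?_
    rintro (_ | i)
    · simp
    · simpa using hmono _
  rw [Nat.add_sub_cancel]
  have h3 : (plantedGF (d + 1) z - plantedGF (d + 1) x) * newtonSum d x (powerGF (d + 1) x) ≤
      (plantedGF (d + 1) z - plantedGF (d + 1) x) * 1 := by linarith
  exact le_of_mul_le_mul_left h3 (sub_pos.2 hlt)

lemma le_half_of_summable (hΔ : 3 ≤ Δ) {x z : ℝ} (hx : 0 < x) (hxz : x < z) (hz : z ≤ 1)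
    (h : Summable fun n => (pTotal Δ n : ℝ) * z ^ n) : x ≤ 1 / 2 := by
  have h1 := newtonSum_le_one (by omega) hx hxz hz h
  have h2 := plantedGF_eq (by omega) hx.le (hxz.le.trans hz) (summable_mul_pow_mono hx.le hxz.le h)
  have h3 := le_newtonSum (by omega : 2 ≤ Δ) hx.le (powerGF_nonneg (Δ := Δ) hx.le)
  have h4 := le_newtonSum (by omega : 2 ≤ Δ - 1) hx.le (powerGF_nonneg (Δ := Δ) hx.le)
  have h5 : powerGF Δ x 0 = plantedGF Δ x := by simp [powerGF]
  rw [← h2, h5] at h3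
  rw [h5] at h4
  nlinarith

/-- If the derivative of the functional equation at `x₀` is less than one, the series converges
beyond `x₀`. -/
lemma exists_summable_of_newtonSum_lt_one (hΔ : 1 ≤ Δ) {x₀ : ℝ} (hx₀ : 0 < x₀) (hx1 : x₀ < 1)
    (h : Summable fun n => (pTotal Δ n : ℝ) * x₀ ^ n)
    (hlt : newtonSum (Δ - 1) x₀ (powerGF Δ x₀) < 1) :
    ∃ x, x₀ < x ∧ Summable fun n => (pTotal Δ n : ℝ) * x ^ n := by
  obtain ⟨d, rfl⟩ : ∃ d, Δ = d + 1 := ⟨Δ - 1, by omega⟩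
  rw [Nat.add_sub_cancel] at hlt
  set p := plantedGF (d + 1) x₀ with hp
  have hp0 : 0 ≤ p := plantedGF_nonneg hx₀.le
  have hc1 : ContinuousAt
      (fun y => newtonSum d x₀ (Function.update (powerGF (d + 1) x₀) 0 y)) p := by
    refine continuousAt_newtonSum continuousAt_const (fun i => ?_) d
    rcases i with _ | i
    · simpa using! continuousAt_id
    · simpa using continuousAt_const
  have hev1 : ∀ᶠ y in 𝓝 p,
      newtonSum d x₀ (Function.update (powerGF (d + 1) x₀) 0 y) < 1 := by
    refine hc1.eventually_lt continuousAt_const ?_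
    rwa [hp, update_powerGF]
  obtain ⟨y, hy1, hpy⟩ :=
    ((hev1.filter_mono nhdsWithin_le_nhds).and (self_mem_nhdsWithin (s := Set.Ioi p))).exists
  have hpy : p < y := hpy
  have hy0 : 0 ≤ y := hp0.trans hpy.le
  have ht := newtonSum_tangent (d := d) hx₀.le (powerGF_nonneg (Δ := d + 1) hx₀.le) hy0 hp0
  have hy2 : newtonSum (d + 1) x₀ (Function.update (powerGF (d + 1) x₀) 0 y) < y := by
    rw [hp, update_powerGF, ← plantedGF_eq hΔ hx₀.le hx1.le h, ← hp] at ht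
    nlinarith
  have hc2 : ContinuousAt
      (fun x => newtonSum (d + 1) x (Function.update (powerGF (d + 1) x) 0 y)) x₀ := by
    refine continuousAt_newtonSum continuousAt_id (fun i => ?_) _
    rcases i with _ | i
    · simpa using continuousAt_const
    · simp only [Function.update_of_ne (Nat.succ_ne_zero i), powerGF, plantedGF]
      have hpow : x₀ ^ (i + 1 + 1) < x₀ := pow_lt_self_of_lt_one₀ hx₀ hx1 (by omega)
      exact ContinuousAt.comp (f := fun x : ℝ => x ^ (i + 1 + 1))
        (g := fun x : ℝ => ∑' n, (pTotal (d + 1) n : ℝ) * x ^ n)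
        (continuousAt_tsum_mul_pow (by positivity) hpow h) (by fun_prop)
  have hev2 : ∀ᶠ x in 𝓝 x₀,
      newtonSum (d + 1) x (Function.update (powerGF (d + 1) x) 0 y) < y :=
    hc2.eventually_lt continuousAt_const hy2
  have hev3 : ∀ᶠ x : ℝ in 𝓝 x₀, x ^ 2 < x₀ :=
    ContinuousAt.eventually_lt (f := fun x : ℝ => x ^ 2) (by fun_prop) continuousAt_const
      (pow_lt_self_of_lt_one₀ hx₀ hx1 (by omega))
  have hev := (hev2.and (hev3.and (eventually_lt_nhds hx1))).filter_mono
    (nhdsWithin_le_nhds (s := Set.Ioi x₀))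
  obtain ⟨x, ⟨h1, h2, h3⟩, h4⟩ := (hev.and self_mem_nhdsWithin).exists
  have h4 : x₀ < x := h4
  exact ⟨x, h4, summable_of_newtonSum_le hΔ (hx₀.trans h4).le h3.le hy0
    (summable_mul_pow_mono (by positivity) h2.le h) h1.le⟩

end analysis

/-- If `x₀ > 0` is the radius of convergence of `Σ p_n xⁿ`, then
`Σ_{n≥1} p_n^{(Δ−1)} x₀ⁿ` converges with sum `1`. -/
theorem planted_series_at_radius (Δ : ℕ) (hΔ : 3 ≤ Δ) (x₀ : ℝ) (hx₀ : 0 < x₀)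
    (hconv : ∀ x : ℝ, 0 ≤ x → x < x₀ → Summable fun n : ℕ => (pTotal Δ n : ℝ) * x ^ n)
    (hdiv : ∀ x : ℝ, x₀ < x → ¬ Summable fun n : ℕ => (pTotal Δ n : ℝ) * x ^ n) :
    (Summable fun n : ℕ => (pResTotal Δ n : ℝ) * x₀ ^ n) ∧
      ∑' n : ℕ, (pResTotal Δ n : ℝ) * x₀ ^ n = 1 := by
  have hx1 : x₀ < 1 := by
    by_contra! h
    have h1 := le_half_of_summable hΔ (x := 3 / 4) (z := 7 / 8) (by norm_num) (by norm_num)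
      (by norm_num) (hconv _ (by norm_num) (by linarith))
    norm_num at h1
  have hbound : ∀ N, ∑ n ∈ Finset.range N, (pResTotal Δ n : ℝ) * x₀ ^ n ≤ 1 := by
    intro N
    have hc : ContinuousAt
        (fun x : ℝ => ∑ n ∈ Finset.range N, (pResTotal Δ n : ℝ) * x ^ n) x₀ := by fun_prop
    refine le_of_tendsto (hc.tendsto.mono_left (nhdsWithin_le_nhds (s := Set.Iio x₀))) ?_
    filter_upwards [Ioo_mem_nhdsLT hx₀] with x hx
    obtain ⟨hs, he⟩ := pRes_eq (by omega) hx.1.le (hx.2.trans hx1).le (hconv x hx.1.le hx.2)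
    have hx0 := hx.1.le
    refine (hs.sum_le_tsum _ fun n _ => by positivity).trans ?_
    obtain ⟨z, hz1, hz2⟩ := exists_between hx.2
    rw [he]
    exact newtonSum_le_one (by omega) hx.1 hz1 (hz2.trans hx1).le
      (hconv z (hx.1.trans hz1).le hz2)
  have hs : Summable fun n : ℕ => (pResTotal Δ n : ℝ) * x₀ ^ n :=
    summable_of_sum_range_le (fun n => by positivity) hbound
  have hP := summable_pTotal_of_pResTotal hΔ hx₀ hs
  refine ⟨hs, le_antisymm (hs.tsum_le_of_sum_range_le hbound) ?_⟩
  by_contra! hlt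
  rw [(pRes_eq (by omega) hx₀.le hx1.le hP).2] at hlt
  obtain ⟨x, hx, hxs⟩ := exists_summable_of_newtonSum_lt_one (by omega) hx₀ hx1 hP hlt
  exact hdiv x hx hxs

end TreePaper
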